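/- arXiv:2209.13085 — 2 statements merged into one kernel-verified Lean document; each statement's English description precedes it below -/
import Mathlib

section
/- Let Π̂ be a set of stationary policies that contains an open set of policies. Then any pair of reward functions R₁, R₂ that are unhackable on Π̂ and both non-trivial on Π̂ are equivalent on Π̂ (i.e., J₁ and J₂ induce the same preference ordering on Π̂). -/
open scoped BigOperators

/-- A rewardless MDP with finite state and action spaces: transition kernel `T`,
initial distribution `I`, and discount factor `γ ∈ (0,1)`. -/
structure MDPnr (S A : Type) [Fintype S] [Fintype A] where
  T : S → A → S → ℝ
  T_nonneg : ∀ s a s', 0 ≤ T s a s'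
  T_sum : ∀ s a, ∑ s', T s a s' = 1
  I : S → ℝ
  I_nonneg : ∀ s, 0 ≤ I s
  I_sum : ∑ s, I s = 1
  γ : ℝ
  γ_pos : 0 < γ
  γ_lt_one : γ < 1

variable {S A : Type} [Fintype S] [Fintype A]

/-- A stationary policy: a distribution over actions in each state. -/
def IsPolicy (π : S → A → ℝ) : Prop :=
  (∀ s a, 0 ≤ π s a) ∧ ∀ s, ∑ a, π s a = 1

/-- The set of all stationary policies. -/
def allPolicies (S A : Type) [Fintype S] [Fintype A] : Set (S → A → ℝ) :=
  {π | IsPolicy π}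

/-- The distribution over states at time `t` induced by policy `π`. -/
def stateDist (M : MDPnr S A) (π : S → A → ℝ) : ℕ → S → ℝ
  | 0 => M.I
  | t + 1 => fun s' => ∑ s, ∑ a, stateDist M π t s * π s a * M.T s a s'

/-- Discounted state-action visit counts `F(π)(s,a) = ∑ₜ γᵗ P(Sₜ = s, Aₜ = a)`. -/
noncomputable def visit (M : MDPnr S A) (π : S → A → ℝ) : S → A → ℝ :=
  fun s a => ∑' t : ℕ, M.γ ^ t * stateDist M π t s * π s a

/-- The visit counts viewed as a vector in `ℝ^{S×A}`. -/
noncomputable def Fvec (M : MDPnr S A) (π : S → A → ℝ) : S × A → ℝ :=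
  fun p => visit M π p.1 p.2

/-- The value `J_R(π) = ∑_{s,a} R(s,a) F(π)(s,a)` of a policy `π` under reward `R`. -/
noncomputable def Jval (M : MDPnr S A) (R : S → A → ℝ) (π : S → A → ℝ) : ℝ :=
  ∑ s, ∑ a, R s a * visit M π s a

/-- `R₁, R₂` are unhackable on policy set `P` if no pair of policies is ordered
oppositely by the two reward functions. -/
def Unhackable (M : MDPnr S A) (P : Set (S → A → ℝ)) (R₁ R₂ : S → A → ℝ) : Prop :=
  ¬ ∃ π ∈ P, ∃ π' ∈ P, Jval M R₁ π < Jval M R₁ π' ∧ Jval M R₂ π > Jval M R₂ π'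

/-- `R₁, R₂` are equivalent on `P` if they induce the same preference ordering. -/
def EquivalentOn (M : MDPnr S A) (P : Set (S → A → ℝ)) (R₁ R₂ : S → A → ℝ) : Prop :=
  ∀ π ∈ P, ∀ π' ∈ P, (Jval M R₁ π ≤ Jval M R₁ π' ↔ Jval M R₂ π ≤ Jval M R₂ π')

/-- `R` is trivial on `P` if its value function is constant on `P`. -/
def TrivialOn (M : MDPnr S A) (P : Set (S → A → ℝ)) (R : S → A → ℝ) : Prop :=
  ∀ π ∈ P, ∀ π' ∈ P, Jval M R π = Jval M R π'

/-- The embedding `G(π)(s,a) = π(a|s)` of policies into `ℝ^{S×A}`. -/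
def Gmap (π : S → A → ℝ) : S × A → ℝ := fun p => π p.1 p.2

/-- A set of stationary policies is open if its image under `G` is open in the
smallest affine subspace of `ℝ^{S×A}` containing the `G`-image of all policies. -/
def OpenPolicySet (Pd : Set (S → A → ℝ)) : Prop :=
  Pd ⊆ allPolicies S A ∧
  IsOpen {x : (affineSpan ℝ (Gmap '' allPolicies S A) : Set (S × A → ℝ)) |
    (x : S × A → ℝ) ∈ Gmap '' Pd}

/-- Every state is reachable (with positive probability) under some policy. -/
def AllReachable (M : MDPnr S A) : Prop :=
  ∀ s : S, ∃ π : S → A → ℝ, IsPolicy π ∧ ∃ t : ℕ, 0 < stateDist M π t s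

/-- `R₂` is a simplification of `R₁` relative to `P`. -/
def Simplification (M : MDPnr S A) (P : Set (S → A → ℝ)) (R₁ R₂ : S → A → ℝ) : Prop :=
  (∀ π ∈ P, ∀ π' ∈ P,
    (Jval M R₁ π < Jval M R₁ π' → Jval M R₂ π ≤ Jval M R₂ π') ∧
    (Jval M R₁ π = Jval M R₁ π' → Jval M R₂ π = Jval M R₂ π')) ∧
  ∃ π ∈ P, ∃ π' ∈ P, Jval M R₂ π = Jval M R₂ π' ∧ Jval M R₁ π ≠ Jval M R₁ π'

open Filter Topology in
theorem OpenPolicySet.eventually_mem {Pd : Set (S → A → ℝ)} (hPd : OpenPolicySet Pd)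
    {π₀ : S → A → ℝ} (h₀ : π₀ ∈ Pd) :
    ∀ᶠ π in 𝓝 π₀, Gmap π ∈ affineSpan ℝ (Gmap '' allPolicies S A) → π ∈ Pd := by
  obtain ⟨hsub, hopen⟩ := hPd
  obtain ⟨U, hU, hUeq⟩ := isOpen_induced_iff.1 hopen
  have key : ∀ π : S → A → ℝ, ∀ h : Gmap π ∈ affineSpan ℝ (Gmap '' allPolicies S A),
      Gmap π ∈ U ↔ Gmap π ∈ Gmap '' Pd := fun π h =>
    Set.ext_iff.1 hUeq ⟨Gmap π, h⟩
  have hspan₀ : Gmap π₀ ∈ affineSpan ℝ (Gmap '' allPolicies S A) :=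
    subset_affineSpan ℝ _ ⟨π₀, hsub h₀, rfl⟩
  have hU₀ : Gmap π₀ ∈ U := (key π₀ hspan₀).2 ⟨π₀, h₀, rfl⟩
  have hcont : Continuous (Gmap : (S → A → ℝ) → S × A → ℝ) := by
    unfold Gmap
    fun_prop
  filter_upwards [hcont.continuousAt.eventually (hU.mem_nhds hU₀)] with π hπ hspan
  obtain ⟨π', hπ', heq⟩ := (key π hspan).1 hπ
  have : π' = π := by
    funext s a
    exact congrFun heq (s, a)
  exact this ▸ hπ'

open Filter Topology in
/-- Members of an open set of policies have full support. -/
theorem OpenPolicySet.pos {Pd : Set (S → A → ℝ)} (hPd : OpenPolicySet Pd)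
    {π₀ : S → A → ℝ} (h₀ : π₀ ∈ Pd) (s : S) (a : A) : 0 < π₀ s a := by
  have : Nonempty A := ⟨a⟩
  have hcard : (0 : ℝ) < Fintype.card A := by exact_mod_cast Fintype.card_pos
  let u : S → A → ℝ := fun _ _ => (Fintype.card A : ℝ)⁻¹
  have hu : u ∈ allPolicies S A :=
    ⟨fun _ _ => inv_nonneg.2 hcard.le, fun _ => by simp [u, hcard.ne']⟩
  let line : ℝ → S → A → ℝ := fun t => π₀ + t • (π₀ - u)
  have hline : Tendsto line (𝓝 0) (𝓝 π₀) := by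
    have : Continuous line := by fun_prop
    simpa [line] using this.tendsto 0
  have hspan : ∀ t, Gmap (line t) ∈ affineSpan ℝ (Gmap '' allPolicies S A) := fun t => by
    have := AffineMap.lineMap_mem (-t)
      (subset_affineSpan ℝ _ ⟨π₀, hPd.1 h₀, rfl⟩ : Gmap π₀ ∈ affineSpan ℝ (Gmap '' allPolicies S A))
      (subset_affineSpan ℝ _ ⟨u, hu, rfl⟩)
    convert this using 1
    funext p
    simp only [Gmap, line, AffineMap.lineMap_apply, Pi.add_apply, Pi.smul_apply, Pi.sub_apply,
      smul_eq_mul, vsub_eq_sub, vadd_eq_add]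
    ring
  have hev : ∀ᶠ t in 𝓝[>] (0 : ℝ), line t ∈ Pd := by
    filter_upwards [(hline.eventually (hPd.eventually_mem h₀)).filter_mono nhdsWithin_le_nhds]
      with t ht using ht (hspan t)
  obtain ⟨t, ht, htpos⟩ := (hev.and self_mem_nhdsWithin).exists
  have htpos : 0 < t := htpos
  have hnonneg := (hPd.1 ht).1 s a
  have hinv : 0 < t * (Fintype.card A : ℝ)⁻¹ := mul_pos htpos (inv_pos.2 hcard)
  simp only [line, u, Pi.add_apply, Pi.smul_apply, Pi.sub_apply, smul_eq_mul] at hnonneg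
  by_contra hneg
  nlinarith [not_lt.1 hneg]

theorem stateDist_nonneg (M : MDPnr S A) {π : S → A → ℝ} (hπ : IsPolicy π) :
    ∀ t s, 0 ≤ stateDist M π t s
  | 0, s => M.I_nonneg s
  | t + 1, s' => Finset.sum_nonneg fun s _ => Finset.sum_nonneg fun a _ =>
      mul_nonneg (mul_nonneg (stateDist_nonneg M hπ t s) (hπ.1 s a)) (M.T_nonneg s a s')

/-- A transition step under a policy preserves total mass. -/
theorem sum_transition (M : MDPnr S A) {π : S → A → ℝ} (hπ : IsPolicy π) (w : S → ℝ) :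
    ∑ s', ∑ s, ∑ a, w s * π s a * M.T s a s' = ∑ s, w s := by
  rw [Finset.sum_comm]
  refine Finset.sum_congr rfl fun s _ => ?_
  rw [Finset.sum_comm]
  simp_rw [← Finset.mul_sum, M.T_sum, mul_one]
  rw [← Finset.mul_sum, hπ.2, mul_one]

theorem sum_stateDist (M : MDPnr S A) {π : S → A → ℝ} (hπ : IsPolicy π) :
    ∀ t, ∑ s, stateDist M π t s = 1
  | 0 => M.I_sum
  | t + 1 => (sum_transition M hπ (stateDist M π t)).trans (sum_stateDist M hπ t)

theorem stateDist_le_one (M : MDPnr S A) {π : S → A → ℝ} (hπ : IsPolicy π) (t : ℕ) (s : S) :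
    stateDist M π t s ≤ 1 :=
  (Finset.single_le_sum (fun s _ => stateDist_nonneg M hπ t s) (Finset.mem_univ s)).trans
    (sum_stateDist M hπ t).le

/-- A full-support policy reaches every state that some policy reaches at the same time. -/
theorem stateDist_pos_of_pos (M : MDPnr S A) {π π₀ : S → A → ℝ} (hπ : IsPolicy π)
    (hπ₀ : IsPolicy π₀) (hpos : ∀ s a, 0 < π₀ s a) :
    ∀ t s, 0 < stateDist M π t s → 0 < stateDist M π₀ t s
  | 0, _, h => h
  | t + 1, s', h => by
    obtain ⟨s, -, hs⟩ := Finset.exists_lt_of_sum_lt (s := Finset.univ) (f := fun _ : S => (0 : ℝ))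
      (g := fun s => ∑ a, stateDist M π t s * π s a * M.T s a s') (by rw [Finset.sum_const_zero]; exact h)
    obtain ⟨a, -, ha⟩ := Finset.exists_lt_of_sum_lt (s := Finset.univ) (f := fun _ : A => (0 : ℝ))
      (g := fun a => stateDist M π t s * π s a * M.T s a s') (by simpa using hs)
    have hT : 0 < M.T s a s' := pos_of_mul_pos_right ha
      (mul_nonneg (stateDist_nonneg M hπ t s) (hπ.1 s a))
    have hd : 0 < stateDist M π t s := pos_of_mul_pos_left
      (pos_of_mul_pos_left ha hT.le) (hπ.1 s a)
    have hterm : ∀ s a, 0 ≤ stateDist M π₀ t s * π₀ s a * M.T s a s' := fun s a =>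
      mul_nonneg (mul_nonneg (stateDist_nonneg M hπ₀ t s) (hπ₀.1 s a)) (M.T_nonneg s a s')
    exact Finset.sum_pos' (fun s _ => Finset.sum_nonneg fun a _ => hterm s a)
      ⟨s, Finset.mem_univ s, Finset.sum_pos' (fun a _ => hterm s a) ⟨a, Finset.mem_univ a,
        mul_pos (mul_pos (stateDist_pos_of_pos M hπ hπ₀ hpos t s hd) (hpos s a)) hT⟩⟩

/-- Discounted state visit counts. -/
noncomputable def stateVisit (M : MDPnr S A) (π : S → A → ℝ) (s : S) : ℝ :=
  ∑' t : ℕ, M.γ ^ t * stateDist M π t s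

theorem visit_eq (M : MDPnr S A) (π : S → A → ℝ) (s : S) (a : A) :
    visit M π s a = stateVisit M π s * π s a :=
  tsum_mul_right

theorem sum_visit (M : MDPnr S A) {π : S → A → ℝ} (hπ : IsPolicy π) (s : S) :
    ∑ a, visit M π s a = stateVisit M π s := by
  simp_rw [visit_eq, ← Finset.mul_sum, hπ.2, mul_one]

theorem summable_stateVisit (M : MDPnr S A) {π : S → A → ℝ} (hπ : IsPolicy π) (s : S) :
    Summable fun t : ℕ => M.γ ^ t * stateDist M π t s :=
  Summable.of_nonneg_of_le
    (fun t => mul_nonneg (pow_nonneg M.γ_pos.le t) (stateDist_nonneg M hπ t s))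
    (fun t => mul_le_of_le_one_right (pow_nonneg M.γ_pos.le t) (stateDist_le_one M hπ t s))
    (summable_geometric_of_lt_one M.γ_pos.le M.γ_lt_one)

theorem stateVisit_pos (M : MDPnr S A) {π : S → A → ℝ} (hπ : IsPolicy π) {t : ℕ} {s : S}
    (h : 0 < stateDist M π t s) : 0 < stateVisit M π s :=
  (summable_stateVisit M hπ s).tsum_pos
    (fun t => mul_nonneg (pow_nonneg M.γ_pos.le t) (stateDist_nonneg M hπ t s)) t
    (mul_pos (pow_pos M.γ_pos t) h)

/-- The Bellman flow equation. -/
theorem stateVisit_flow (M : MDPnr S A) {π : S → A → ℝ} (hπ : IsPolicy π) (s' : S) :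
    stateVisit M π s' =
      M.I s' + M.γ * ∑ s, ∑ a, stateVisit M π s * π s a * M.T s a s' := by
  have hsum : HasSum (fun t : ℕ => M.γ ^ (t + 1) * stateDist M π (t + 1) s')
      (M.γ * ∑ s, ∑ a, stateVisit M π s * π s a * M.T s a s') := by
    have hstep : ∀ t : ℕ, M.γ ^ (t + 1) * stateDist M π (t + 1) s' =
        M.γ * ∑ s, ∑ a, M.γ ^ t * stateDist M π t s * π s a * M.T s a s' := fun t => by
      simp only [stateDist, Finset.mul_sum]
      refine Finset.sum_congr rfl fun s _ => Finset.sum_congr rfl fun a _ => ?_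
      ring
    simp_rw [hstep]
    exact (hasSum_sum fun s _ => hasSum_sum fun a _ =>
      ((summable_stateVisit M hπ s).hasSum.mul_right (π s a)).mul_right (M.T s a s')).mul_left M.γ
  rw [stateVisit, (summable_stateVisit M hπ s').tsum_eq_zero_add, hsum.tsum_eq]
  simp [stateDist]

/-- The Bellman flow equation has only one solution. -/
theorem eq_stateVisit_of_flow (M : MDPnr S A) {π : S → A → ℝ} (hπ : IsPolicy π) {x : S → ℝ}
    (hx : ∀ s', x s' = M.I s' + M.γ * ∑ s, ∑ a, x s * π s a * M.T s a s') :
    x = stateVisit M π := by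
  set w : S → ℝ := fun s => x s - stateVisit M π s with hw
  have hflow : ∀ s', w s' = M.γ * ∑ s, ∑ a, w s * π s a * M.T s a s' := fun s' => by
    simp only [hw, sub_mul, Finset.sum_sub_distrib]
    rw [hx s', stateVisit_flow M hπ s']
    ring
  have hle : ∑ s, |w s| ≤ M.γ * ∑ s, |w s| := by
    rw [← sum_transition M hπ fun s => |w s|, Finset.mul_sum, sum_transition M hπ fun s => |w s|]
    refine Finset.sum_le_sum fun s' _ => ?_
    rw [hflow s', abs_mul, abs_of_pos M.γ_pos]
    refine mul_le_mul_of_nonneg_left ?_ M.γ_pos.le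
    refine (Finset.abs_sum_le_sum_abs _ _).trans (Finset.sum_le_sum fun s _ => ?_)
    refine (Finset.abs_sum_le_sum_abs _ _).trans (Finset.sum_le_sum fun a _ => ?_)
    rw [abs_mul, abs_mul, abs_of_nonneg (hπ.1 s a), abs_of_nonneg (M.T_nonneg s a s')]
  have hnonneg : 0 ≤ ∑ s, |w s| := Finset.sum_nonneg fun s _ => abs_nonneg _
  have hzero : ∑ s, |w s| = 0 := by nlinarith [M.γ_lt_one]
  funext s
  have := (Finset.sum_eq_zero_iff_of_nonneg fun s _ => abs_nonneg (w s)).1 hzero s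
    (Finset.mem_univ s)
  exact sub_eq_zero.1 (abs_eq_zero.1 this)

/-- The direction space of the affine space of solutions of the Bellman flow equation. -/
def flowDirections (M : MDPnr S A) : Submodule ℝ (S → A → ℝ) where
  carrier := {d | ∀ s', ∑ a, d s' a = M.γ * ∑ s, ∑ a, d s a * M.T s a s'}
  add_mem' {d e} hd he s' := by
    simp only [Pi.add_apply, add_mul, Finset.sum_add_distrib, mul_add, hd s', he s']
  zero_mem' s' := by simp
  smul_mem' c d hd s' := by
    simp only [Pi.smul_apply, smul_eq_mul, mul_assoc, ← Finset.mul_sum, hd s']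
    ring

theorem mem_flowDirections {M : MDPnr S A} {d : S → A → ℝ} :
    d ∈ flowDirections M ↔ ∀ s', ∑ a, d s' a = M.γ * ∑ s, ∑ a, d s a * M.T s a s' :=
  Iff.rfl

theorem visit_flow (M : MDPnr S A) {π : S → A → ℝ} (hπ : IsPolicy π) (s' : S) :
    ∑ a, visit M π s' a = M.I s' + M.γ * ∑ s, ∑ a, visit M π s a * M.T s a s' := by
  rw [sum_visit M hπ, stateVisit_flow M hπ]
  simp_rw [visit_eq]

theorem visit_sub_mem_flowDirections (M : MDPnr S A) {π π' : S → A → ℝ} (hπ : IsPolicy π)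
    (hπ' : IsPolicy π') : visit M π - visit M π' ∈ flowDirections M := by
  refine mem_flowDirections.2 fun s' => ?_
  simp only [Pi.sub_apply, sub_mul, Finset.sum_sub_distrib]
  rw [visit_flow M hπ, visit_flow M hπ']
  ring

/-- Normalizing the rows of a solution of the Bellman flow equation recovers a policy that
generates it. -/
theorem visit_normalize (M : MDPnr S A) {y : S → A → ℝ} (hsum : ∀ s, ∑ b, y s b ≠ 0)
    (hflow : ∀ s', ∑ a, y s' a = M.I s' + M.γ * ∑ s, ∑ a, y s a * M.T s a s')
    (hπ : IsPolicy fun s a => y s a / ∑ b, y s b) :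
    visit M (fun s a => y s a / ∑ b, y s b) = y := by
  have hmul : ∀ s a, (∑ b, y s b) * (y s a / ∑ b, y s b) = y s a := fun s a =>
    mul_div_cancel₀ _ (hsum s)
  have := eq_stateVisit_of_flow M hπ (x := fun s => ∑ b, y s b) fun s' => by
    simp only [hmul]
    exact hflow s'
  funext s a
  rw [visit_eq, ← this, hmul]

open Filter Topology in
/-- From an interior policy, the visit counts can be moved slightly in every flow direction
without leaving the visit counts of the open set. -/
theorem OpenPolicySet.exists_visit_eq_add_smul (M : MDPnr S A) (hreach : AllReachable M)
    {Pd : Set (S → A → ℝ)} (hPd : OpenPolicySet Pd) {π₀ : S → A → ℝ} (h₀ : π₀ ∈ Pd)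
    {d : S → A → ℝ} (hd : d ∈ flowDirections M) :
    ∃ ε > (0 : ℝ), ∃ π ∈ Pd, visit M π = visit M π₀ + ε • d := by
  have hπ₀ : IsPolicy π₀ := hPd.1 h₀
  have hpos : ∀ s a, 0 < π₀ s a := hPd.pos h₀
  have hν : ∀ s, 0 < stateVisit M π₀ s := fun s => by
    obtain ⟨π, hπ, t, ht⟩ := hreach s
    exact stateVisit_pos M hπ₀ (stateDist_pos_of_pos M hπ hπ₀ hpos t s ht)
  let y : ℝ → S → A → ℝ := fun ε => visit M π₀ + ε • d
  let p : ℝ → S → A → ℝ := fun ε s a => y ε s a / ∑ b, y ε s b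
  have hy0 : y 0 = visit M π₀ := by simp [y]
  have hp0 : p 0 = π₀ := by
    funext s a
    simp only [p, hy0, sum_visit M hπ₀]
    rw [visit_eq]
    exact mul_div_cancel_left₀ _ (hν s).ne'
  have hycont : ∀ s a, Continuous fun ε => y ε s a := fun s a => by
    simp only [y, Pi.add_apply, Pi.smul_apply]
    fun_prop
  have hsumcont : ∀ s, Continuous fun ε => ∑ b, y ε s b := fun s =>
    continuous_finsetSum _ fun b _ => hycont s b
  have hsum0 : ∀ s, 0 < ∑ b, y 0 s b := fun s => by
    rw [hy0, sum_visit M hπ₀]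
    exact hν s
  have hpcont : ContinuousAt p 0 := continuousAt_pi.2 fun s => continuousAt_pi.2 fun a =>
    (hycont s a).continuousAt.div (hsumcont s).continuousAt (hsum0 s).ne'
  have hsumev : ∀ᶠ ε in 𝓝 (0 : ℝ), ∀ s, 0 < ∑ b, y ε s b := eventually_all.2 fun s =>
    (hsumcont s).continuousAt.eventually (lt_mem_nhds (hsum0 s))
  have hpev : ∀ᶠ ε in 𝓝 (0 : ℝ), ∀ s a, 0 < p ε s a :=
    eventually_all.2 fun s => eventually_all.2 fun a =>
      (continuousAt_pi.1 (continuousAt_pi.1 hpcont s) a).eventually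
        (lt_mem_nhds ((hpos s a).trans_eq (congrFun (congrFun hp0.symm s) a)))
  have hmem := hpcont.eventually (by rw [hp0]; exact hPd.eventually_mem h₀)
  obtain ⟨ε, ⟨hsum, hp, hm⟩, hε⟩ :=
    (((hsumev.and (hpev.and hmem)).filter_mono nhdsWithin_le_nhds).and
      (self_mem_nhdsWithin : Set.Ioi (0 : ℝ) ∈ 𝓝[>] 0)).exists
  have hpol : IsPolicy (p ε) := ⟨fun s a => (hp s a).le, fun s => by
    rw [← Finset.sum_div, div_self (hsum s).ne']⟩
  refine ⟨ε, hε, p ε, hm (subset_affineSpan ℝ _ ⟨p ε, hpol, rfl⟩),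
    visit_normalize M (fun s => (hsum s).ne') (fun s' => ?_) hpol⟩
  simp only [y, Pi.add_apply, Pi.smul_apply, smul_eq_mul, add_mul, Finset.sum_add_distrib,
    mul_assoc, ← Finset.mul_sum]
  rw [visit_flow M hπ₀, mem_flowDirections.1 hd]
  ring

/-- The value of a vector of visit counts under the reward `R`, as a linear functional. -/
def rewardFunctional (R : S → A → ℝ) : (S → A → ℝ) →ₗ[ℝ] ℝ where
  toFun x := ∑ s, ∑ a, R s a * x s a
  map_add' x y := by simp only [Pi.add_apply, mul_add, Finset.sum_add_distrib]
  map_smul' c x := by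
    simp only [Pi.smul_apply, smul_eq_mul, RingHom.id_apply, Finset.mul_sum]
    simp only [mul_left_comm]

theorem Jval_eq (M : MDPnr S A) (R π : S → A → ℝ) :
    Jval M R π = rewardFunctional R (visit M π) :=
  rfl

open Filter Topology in
/-- If two linear functionals are never of strictly opposite sign on a subspace, and the second
does not vanish on it, then the second is positive wherever the first is. -/
theorem LinearMap.pos_of_pos_of_forall_nonneg {E : Type*} [AddCommGroup E] [Module ℝ E]
    {V : Submodule ℝ E} {f g : E →ₗ[ℝ] ℝ} (h : ∀ v ∈ V, 0 < f v → 0 ≤ g v)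
    (hg : ∃ v ∈ V, g v ≠ 0) {v : E} (hv : v ∈ V) (hfv : 0 < f v) : 0 < g v := by
  refine (h v hv hfv).lt_of_ne' fun hgv => ?_
  obtain ⟨w, hw, hgw⟩ : ∃ w ∈ V, g w < 0 := by
    obtain ⟨w, hw, hgw⟩ := hg
    rcases hgw.lt_or_gt with h' | h'
    · exact ⟨w, hw, h'⟩
    · exact ⟨-w, V.neg_mem hw, by simpa using h'⟩
  have hcont : Continuous fun t : ℝ => f v + t * f w := by fun_prop
  have hev : ∀ᶠ t in 𝓝[>] (0 : ℝ), 0 < f v + t * f w :=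
    (hcont.continuousAt.eventually (lt_mem_nhds (by simpa using hfv))).filter_mono
      nhdsWithin_le_nhds
  obtain ⟨t, hft, ht⟩ := (hev.and (self_mem_nhdsWithin : Set.Ioi (0 : ℝ) ∈ 𝓝[>] 0)).exists
  have := h (v + t • w) (V.add_mem hv (V.smul_mem t hw)) (by simpa using hft)
  simp only [map_add, map_smul, smul_eq_mul, hgv, zero_add] at this
  exact this.not_gt (mul_neg_of_pos_of_neg ht hgw)

theorem exists_flowDirection_ne_zero (M : MDPnr S A) {P : Set (S → A → ℝ)}
    (hP : P ⊆ allPolicies S A) {R : S → A → ℝ} (h : ¬ TrivialOn M P R) :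
    ∃ d ∈ flowDirections M, rewardFunctional R d ≠ 0 := by
  simp only [TrivialOn, not_forall] at h
  obtain ⟨π, hπ, π', hπ', hne⟩ := h
  refine ⟨_, visit_sub_mem_flowDirections M (hP hπ) (hP hπ'), ?_⟩
  rw [map_sub]
  exact sub_ne_zero.2 hne

/-- If `Phat` contains a (nonempty) open set of stationary policies, then
any pair of reward functions that are unhackable and both non-trivial on `Phat` are
equivalent on `Phat`. -/
theorem unhackable_nontrivial_equivalent_of_contains_open
    (M : MDPnr S A) (hA : 1 < Fintype.card A) (hreach : AllReachable M)
    (Phat : Set (S → A → ℝ)) (hsub : Phat ⊆ allPolicies S A)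
    (hopen : ∃ Pd : Set (S → A → ℝ), OpenPolicySet Pd ∧ Pd.Nonempty ∧ Pd ⊆ Phat)
    (R₁ R₂ : S → A → ℝ)
    (hunh : Unhackable M Phat R₁ R₂)
    (h1 : ¬ TrivialOn M Phat R₁) (h2 : ¬ TrivialOn M Phat R₂) :
    EquivalentOn M Phat R₁ R₂ := by
  obtain ⟨Pd, hPd, ⟨π₀, h₀⟩, hPdsub⟩ := hopen
  have h12 : ∀ d ∈ flowDirections M,
      0 < rewardFunctional R₁ d → 0 ≤ rewardFunctional R₂ d := by
    intro d hd hpos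
    by_contra! hneg
    obtain ⟨ε, hε, π, hπ, heq⟩ := hPd.exists_visit_eq_add_smul M hreach h₀ hd
    refine hunh ⟨π₀, hPdsub h₀, π, hPdsub hπ, ?_⟩
    simp only [Jval_eq, heq, map_add, map_smul, smul_eq_mul]
    constructor <;> nlinarith
  have h21 : ∀ d ∈ flowDirections M,
      0 < rewardFunctional R₂ d → 0 ≤ rewardFunctional R₁ d := by
    intro d hd hpos
    by_contra! hneg
    have := h12 (-d) ((flowDirections M).neg_mem hd) (by simpa using hneg)
    rw [map_neg] at this
    linarith
  intro π hπ π' hπ'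
  have hd := visit_sub_mem_flowDirections M (hsub hπ) (hsub hπ')
  have hiff : 0 < rewardFunctional R₁ (visit M π - visit M π') ↔
      0 < rewardFunctional R₂ (visit M π - visit M π') :=
    ⟨LinearMap.pos_of_pos_of_forall_nonneg h12 (exists_flowDirection_ne_zero M hsub h2) hd,
      LinearMap.pos_of_pos_of_forall_nonneg h21 (exists_flowDirection_ne_zero M hsub h1) hd⟩
  rw [map_sub, map_sub, sub_pos, sub_pos] at hiff
  simpa only [Jval_eq, not_lt] using not_congr hiff
end

section
/- Let Π^N be the set of all non-stationary policies (including all probabilistic mixtures of policies). If two reward functions R₁, R₂ are unhackable on Π^N and both non-trivial on Π^N, then R₁ and R₂ are equivalent on Π^N; that is, J₁(π) ≤ J₁(π') if and only if J₂(π) ≤ J₂(π') for all π, π' ∈ Π^N. -/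
open scoped BigOperators

variable {S A : Type} [Fintype S] [Fintype A]

/-- A non-stationary policy: a distribution over actions given the (chronological)
history of past state-action pairs and the current state. -/
def IsNSPolicy (π : List (S × A) → S → A → ℝ) : Prop :=
  (∀ h s a, 0 ≤ π h s a) ∧ ∀ h s, ∑ a, π h s a = 1

/-- `histProb M π h s` is the probability that the trajectory starts with the history
`h` (given in reverse-chronological order) and is currently in state `s`. -/
def histProb (M : MDPnr S A) (π : List (S × A) → S → A → ℝ) : List (S × A) → S → ℝ
  | [], s => M.I s
  | p :: rest, s => histProb M π rest p.1 * π rest.reverse p.1 p.2 * M.T p.1 p.2 s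

/-- The value `J_R(π) = E[∑ₜ γᵗ R(Sₜ,Aₜ)]` of a non-stationary policy `π`, written as a
sum over all finite histories. -/
noncomputable def JvalNS (M : MDPnr S A) (R : S → A → ℝ)
    (π : List (S × A) → S → A → ℝ) : ℝ :=
  ∑' q : List (S × A) × S × A,
    M.γ ^ q.1.length * histProb M π q.1 q.2.1 * π q.1.reverse q.2.1 q.2.2 *
      R q.2.1 q.2.2

theorem histProb_nonneg (M : MDPnr S A) {π : List (S × A) → S → A → ℝ} (hπ : IsNSPolicy π)
    (h : List (S × A)) (s : S) : 0 ≤ histProb M π h s := by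
  induction h generalizing s with
  | nil => exact M.I_nonneg s
  | cons p rest ih =>
    exact mul_nonneg (mul_nonneg (ih _) (hπ.1 _ _ _)) (M.T_nonneg _ _ _)

/-- The discounted probability that a trajectory starts with the reversed history `h`. -/
noncomputable def discountedHistProb (M : MDPnr S A) (π : List (S × A) → S → A → ℝ)
    (h : List (S × A)) : ℝ :=
  ∑ s, M.γ ^ h.length * histProb M π h s

theorem discountedHistProb_nonneg (M : MDPnr S A) {π : List (S × A) → S → A → ℝ}
    (hπ : IsNSPolicy π) (h : List (S × A)) : 0 ≤ discountedHistProb M π h :=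
  Finset.sum_nonneg fun s _ =>
    mul_nonneg (pow_nonneg M.γ_pos.le _) (histProb_nonneg M hπ h s)

theorem discountedHistProb_nil (M : MDPnr S A) (π : List (S × A) → S → A → ℝ) :
    discountedHistProb M π [] = 1 := by
  simp [discountedHistProb, histProb, M.I_sum]

theorem sum_discountedHistProb_cons (M : MDPnr S A) {π : List (S × A) → S → A → ℝ}
    (hπ : IsNSPolicy π) (h : List (S × A)) :
    ∑ p, discountedHistProb M π (p :: h) = M.γ * discountedHistProb M π h := by
  have hp (p : S × A) : discountedHistProb M π (p :: h) =
      M.γ ^ (h.length + 1) * histProb M π h p.1 * π h.reverse p.1 p.2 := by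
    simp only [discountedHistProb, histProb, List.length_cons]
    rw [← Finset.mul_sum, ← Finset.mul_sum, M.T_sum]
    ring
  simp only [hp, Fintype.sum_prod_type]
  simp only [← Finset.mul_sum, hπ.2, discountedHistProb]
  rw [Finset.mul_sum, Finset.mul_sum]
  exact Finset.sum_congr rfl fun s _ => by ring

theorem sum_discountedHistProb_le (M : MDPnr S A) {π : List (S × A) → S → A → ℝ}
    (hπ : IsNSPolicy π) (n : ℕ) (u : Finset (List (S × A))) (hu : ∀ h ∈ u, h.length ≤ n) :
    ∑ h ∈ u, discountedHistProb M π h ≤ 1 / (1 - M.γ) := by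
  classical
  have hγ : 0 < 1 - M.γ := sub_pos.2 M.γ_lt_one
  have hone : 1 ≤ 1 / (1 - M.γ) := by
    rw [le_div_iff₀ hγ]
    linarith [M.γ_pos]
  have hnonneg := discountedHistProb_nonneg M hπ
  induction n generalizing u with
  | zero =>
    have hsub : u ⊆ {[]} := fun h hh => by simpa using hu h hh
    refine (Finset.sum_le_sum_of_subset_of_nonneg hsub fun h _ _ => hnonneg h).trans ?_
    simpa [discountedHistProb_nil] using hone
  | succ n ih =>
    set v : Finset (List (S × A)) := u.image List.tail
    have hv : ∀ h ∈ v, h.length ≤ n := by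
      intro h hh
      obtain ⟨g, hg, rfl⟩ := Finset.mem_image.1 hh
      have := hu g hg
      simp only [List.length_tail]
      omega
    have hsub : u ⊆ insert [] ((v ×ˢ (Finset.univ : Finset (S × A))).image
        fun q => q.2 :: q.1) := by
      intro h hh
      cases h with
      | nil => simp
      | cons p t =>
        have ht : t ∈ v := Finset.mem_image.2 ⟨p :: t, hh, rfl⟩
        exact Finset.mem_insert_of_mem (Finset.mem_image.2 ⟨(t, p), by simp [ht], rfl⟩)
    calc ∑ h ∈ u, discountedHistProb M π h
        ≤ _ := Finset.sum_le_sum_of_subset_of_nonneg hsub fun h _ _ => hnonneg h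
      _ = 1 + ∑ t ∈ v, M.γ * discountedHistProb M π t := by
        rw [Finset.sum_insert (by simp), discountedHistProb_nil, Finset.sum_image,
          Finset.sum_product]
        · simp only [sum_discountedHistProb_cons M hπ]
        · rintro ⟨a, b⟩ _ ⟨c, d⟩ _ hcd
          simp only [List.cons.injEq] at hcd
          simp [hcd.1, hcd.2]
      _ ≤ 1 + M.γ * (1 / (1 - M.γ)) := by
        rw [← Finset.mul_sum]
        have := mul_le_mul_of_nonneg_left (ih v hv) M.γ_pos.le
        linarith
      _ = 1 / (1 - M.γ) := by
        field_simp
        ring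

theorem summable_discountedHistProb (M : MDPnr S A) {π : List (S × A) → S → A → ℝ}
    (hπ : IsNSPolicy π) : Summable (discountedHistProb M π) :=
  summable_of_sum_le (discountedHistProb_nonneg M hπ) fun u =>
    sum_discountedHistProb_le M hπ (u.sup List.length) u fun _ hh =>
      Finset.le_sup (f := List.length) hh

theorem summable_JvalNS (M : MDPnr S A) (R : S → A → ℝ) {π : List (S × A) → S → A → ℝ}
    (hπ : IsNSPolicy π) :
    Summable fun q : List (S × A) × S × A =>
      M.γ ^ q.1.length * histProb M π q.1 q.2.1 * π q.1.reverse q.2.1 q.2.2 *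
        R q.2.1 q.2.2 := by
  have hnonneg (q : List (S × A) × S × A) :
      0 ≤ M.γ ^ q.1.length * histProb M π q.1 q.2.1 * π q.1.reverse q.2.1 q.2.2 :=
    mul_nonneg (mul_nonneg (pow_nonneg M.γ_pos.le _) (histProb_nonneg M hπ _ _)) (hπ.1 _ _ _)
  have hsum : Summable fun q : List (S × A) × S × A =>
      M.γ ^ q.1.length * histProb M π q.1 q.2.1 * π q.1.reverse q.2.1 q.2.2 := by
    rw [summable_prod_of_nonneg hnonneg]
    refine ⟨fun _ => Summable.of_finite, (summable_discountedHistProb M hπ).congr fun h => ?_⟩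
    simp only [tsum_fintype, Fintype.sum_prod_type, ← Finset.mul_sum, hπ.2, mul_one,
      discountedHistProb]
  refine (hsum.mul_right (∑ p : S × A, |R p.1 p.2|)).of_norm_bounded fun q => ?_
  rw [Real.norm_eq_abs, abs_mul, abs_of_nonneg (hnonneg q)]
  exact mul_le_mul_of_nonneg_left
    (Finset.single_le_sum (f := fun p : S × A => |R p.1 p.2|) (fun _ _ => abs_nonneg _)
      (Finset.mem_univ q.2)) (hnonneg q)

/-- The behaviour policy realising the mixture that plays `π` with probability `a` and
`π'` with probability `b`. -/
noncomputable def mixPolicy (M : MDPnr S A) (a b : ℝ) (π π' : List (S × A) → S → A → ℝ) :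
    List (S × A) → S → A → ℝ := fun h s x =>
  if a * histProb M π h.reverse s + b * histProb M π' h.reverse s = 0 then π h s x
  else (a * histProb M π h.reverse s * π h s x + b * histProb M π' h.reverse s * π' h s x) /
    (a * histProb M π h.reverse s + b * histProb M π' h.reverse s)

section Mixture

variable (M : MDPnr S A) {a b : ℝ} {π π' : List (S × A) → S → A → ℝ}

theorem isNSPolicy_mixPolicy (ha : 0 ≤ a) (hb : 0 ≤ b)
    (hπ : IsNSPolicy π) (hπ' : IsNSPolicy π') : IsNSPolicy (mixPolicy M a b π π') := by
  have hP (h s) : 0 ≤ a * histProb M π h s := mul_nonneg ha (histProb_nonneg M hπ h s)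
  have hP' (h s) : 0 ≤ b * histProb M π' h s := mul_nonneg hb (histProb_nonneg M hπ' h s)
  refine ⟨fun h s x => ?_, fun h s => ?_⟩
  · unfold mixPolicy
    split_ifs with h0
    · exact hπ.1 _ _ _
    · exact div_nonneg (add_nonneg (mul_nonneg (hP _ _) (hπ.1 _ _ _))
        (mul_nonneg (hP' _ _) (hπ'.1 _ _ _))) (add_nonneg (hP _ _) (hP' _ _))
  · unfold mixPolicy
    split_ifs with h0
    · exact hπ.2 _ _
    · rw [← Finset.sum_div, Finset.sum_add_distrib, ← Finset.mul_sum, ← Finset.mul_sum,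
        hπ.2, hπ'.2, mul_one, mul_one, div_self h0]

theorem mul_mixPolicy (ha : 0 ≤ a) (hb : 0 ≤ b)
    (hπ : IsNSPolicy π) (hπ' : IsNSPolicy π') (h : List (S × A)) (s : S) (x : A) :
    (a * histProb M π h s + b * histProb M π' h s) * mixPolicy M a b π π' h.reverse s x =
      a * histProb M π h s * π h.reverse s x + b * histProb M π' h s * π' h.reverse s x := by
  unfold mixPolicy
  rw [List.reverse_reverse]
  split_ifs with h0
  · have hP : 0 ≤ a * histProb M π h s := mul_nonneg ha (histProb_nonneg M hπ h s)
    have hP' : 0 ≤ b * histProb M π' h s := mul_nonneg hb (histProb_nonneg M hπ' h s)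
    have h1 : a * histProb M π h s = 0 := by linarith
    have h2 : b * histProb M π' h s = 0 := by linarith
    simp [h1, h2]
  · rw [mul_div_cancel₀ _ h0]

theorem histProb_mixPolicy (ha : 0 ≤ a) (hb : 0 ≤ b) (hab : a + b = 1)
    (hπ : IsNSPolicy π) (hπ' : IsNSPolicy π') (h : List (S × A)) (s : S) :
    histProb M (mixPolicy M a b π π') h s =
      a * histProb M π h s + b * histProb M π' h s := by
  induction h generalizing s with
  | nil => simp only [histProb, ← add_mul, hab, one_mul]
  | cons p rest ih =>
    simp only [histProb]
    rw [ih, mul_mixPolicy M ha hb hπ hπ']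
    ring

theorem JvalNS_mixPolicy (R : S → A → ℝ) (ha : 0 ≤ a) (hb : 0 ≤ b) (hab : a + b = 1)
    (hπ : IsNSPolicy π) (hπ' : IsNSPolicy π') :
    JvalNS M R (mixPolicy M a b π π') = a * JvalNS M R π + b * JvalNS M R π' := by
  unfold JvalNS
  rw [← tsum_mul_left, ← tsum_mul_left, ← ((summable_JvalNS M R hπ).mul_left a).tsum_add
    ((summable_JvalNS M R hπ').mul_left b)]
  refine tsum_congr fun q => ?_
  rw [histProb_mixPolicy M ha hb hab hπ hπ', mul_assoc (M.γ ^ _),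
    mul_mixPolicy M ha hb hπ hπ']
  ring

end Mixture

/-- If `J₁` is not constant and `R₁, R₂` are unhackable, then `J₁` orders policies only in
ways that `J₂` agrees with: otherwise, small perturbations of `π, π'` would be hackable. -/
theorem JvalNS_le_of_unhackable (M : MDPnr S A) {R₁ R₂ : S → A → ℝ}
    (hunh : ∀ π π' : List (S × A) → S → A → ℝ, IsNSPolicy π → IsNSPolicy π' →
      JvalNS M R₁ π < JvalNS M R₁ π' → JvalNS M R₂ π ≤ JvalNS M R₂ π')
    (h1 : ¬ ∀ π π' : List (S × A) → S → A → ℝ, IsNSPolicy π → IsNSPolicy π' →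
      JvalNS M R₁ π = JvalNS M R₁ π')
    {π π' : List (S × A) → S → A → ℝ} (hπ : IsNSPolicy π) (hπ' : IsNSPolicy π')
    (hle : JvalNS M R₁ π ≤ JvalNS M R₁ π') : JvalNS M R₂ π ≤ JvalNS M R₂ π' := by
  obtain ⟨p, q, hp, hq, hpq⟩ : ∃ p q : List (S × A) → S → A → ℝ,
      IsNSPolicy p ∧ IsNSPolicy q ∧ JvalNS M R₁ p < JvalNS M R₁ q := by
    push Not at h1
    obtain ⟨p, q, hp, hq, hne⟩ := h1
    rcases hne.lt_or_gt with h | h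
    · exact ⟨p, q, hp, hq, h⟩
    · exact ⟨q, p, hq, hp, h⟩
  by_contra! hlt
  set d := JvalNS M R₂ π - JvalNS M R₂ π' with hd
  set e := JvalNS M R₂ q - JvalNS M R₂ p with he
  have hd0 : 0 < d := sub_pos.2 hlt
  have he0 : 0 ≤ e := sub_nonneg.2 (hunh p q hp hq hpq)
  -- With weight `c = d / (d + e + d)` on `(p, q)`, the gap `d` in `J₂` still dominates.
  have hD : 0 < d + e + d := by linarith
  set c := d / (d + e + d)
  have hc0 : 0 < c := div_pos hd0 hD
  have hcD : c * (d + e + d) = d := div_mul_cancel₀ d hD.ne'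
  have hc1 : c ≤ 1 := (div_le_one hD).2 (by linarith)
  have hb : 0 ≤ 1 - c := sub_nonneg.2 hc1
  have hab : 1 - c + c = 1 := sub_add_cancel 1 c
  have key := hunh _ _ (isNSPolicy_mixPolicy M hb hc0.le hπ hp)
    (isNSPolicy_mixPolicy M hb hc0.le hπ' hq)
  simp only [JvalNS_mixPolicy M _ hb hc0.le hab hπ hp,
    JvalNS_mixPolicy M _ hb hc0.le hab hπ' hq] at key
  have h2 := key (add_lt_add_of_le_of_lt (mul_le_mul_of_nonneg_left hle hb)
    (mul_lt_mul_of_pos_left hpq hc0))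
  have h3 : (1 - c) * d ≤ c * e := by
    rw [hd, he]
    linarith
  have h4 : 0 < c * d := mul_pos hc0 hd0
  linarith


/-- On the set of all non-stationary policies, any pair of unhackable,
non-trivial reward functions are equivalent. -/
theorem unhackable_nontrivial_equivalent_nonstationary
    (M : MDPnr S A) (hA : 1 < Fintype.card A)
    (R₁ R₂ : S → A → ℝ)
    (hunh : ¬ ∃ π : List (S × A) → S → A → ℝ, IsNSPolicy π ∧
        ∃ π' : List (S × A) → S → A → ℝ, IsNSPolicy π' ∧
          JvalNS M R₁ π < JvalNS M R₁ π' ∧ JvalNS M R₂ π > JvalNS M R₂ π')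
    (h1 : ¬ ∀ π π' : List (S × A) → S → A → ℝ, IsNSPolicy π → IsNSPolicy π' →
        JvalNS M R₁ π = JvalNS M R₁ π')
    (h2 : ¬ ∀ π π' : List (S × A) → S → A → ℝ, IsNSPolicy π → IsNSPolicy π' →
        JvalNS M R₂ π = JvalNS M R₂ π') :
    ∀ π π' : List (S × A) → S → A → ℝ, IsNSPolicy π → IsNSPolicy π' →
      (JvalNS M R₁ π ≤ JvalNS M R₁ π' ↔ JvalNS M R₂ π ≤ JvalNS M R₂ π') := by
  have hunh₁ : ∀ π π' : List (S × A) → S → A → ℝ, IsNSPolicy π → IsNSPolicy π' →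
      JvalNS M R₁ π < JvalNS M R₁ π' → JvalNS M R₂ π ≤ JvalNS M R₂ π' :=
    fun π π' hπ hπ' hlt => not_lt.1 fun hgt => hunh ⟨π, hπ, π', hπ', hlt, hgt⟩
  have hunh₂ : ∀ π π' : List (S × A) → S → A → ℝ, IsNSPolicy π → IsNSPolicy π' →
      JvalNS M R₂ π < JvalNS M R₂ π' → JvalNS M R₁ π ≤ JvalNS M R₁ π' :=
    fun π π' hπ hπ' hlt => not_lt.1 fun hgt => hunh ⟨π', hπ', π, hπ, hgt, hlt⟩
  exact fun π π' hπ hπ' => ⟨JvalNS_le_of_unhackable M hunh₁ h1 hπ hπ',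
    JvalNS_le_of_unhackable M hunh₂ h2 hπ hπ'⟩
end
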